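/- Let A be the real 2×2 matrix with rows (2,1) and (2,2). Then the sequence c_k := (2+√2)^{-k}·( (A^{k-1})_{2,1}·(√2−1) + (A^{k-1})_{2,2}·(2−√2) ), k ≥ 1, converges as k → ∞ and its limit equals 3 − 2√2. -/

import Mathlib

/-- The vector `(√2 - 1, 2 - √2)` is an eigenvector of `!![2, 1; 2, 2]` for `2 + √2`; this is the
second coordinate of the resulting identity for powers. -/
theorem matrix_pow_apply_eigenvector (n : ℕ) :
    ((!![2, 1; 2, 2] : Matrix (Fin 2) (Fin 2) ℝ) ^ n) 1 0 * (Real.sqrt 2 - 1) +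
      ((!![2, 1; 2, 2] : Matrix (Fin 2) (Fin 2) ℝ) ^ n) 1 1 * (2 - Real.sqrt 2) =
    (2 + Real.sqrt 2) ^ n * (2 - Real.sqrt 2) := by
  have hs : Real.sqrt 2 ^ 2 = 2 := Real.sq_sqrt (by norm_num)
  induction n with
  | zero => simp
  | succ n ih =>
    rw [pow_succ, Matrix.mul_apply, Matrix.mul_apply, pow_succ (2 + Real.sqrt 2)]
    simp only [Fin.sum_univ_two, Matrix.of_apply, Matrix.cons_val_zero, Matrix.cons_val_one]
    generalize ((!![2, 1; 2, 2] : Matrix (Fin 2) (Fin 2) ℝ) ^ n) 1 0 = a at *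
    generalize ((!![2, 1; 2, 2] : Matrix (Fin 2) (Fin 2) ℝ) ^ n) 1 1 = b at *
    linear_combination (2 + Real.sqrt 2) * ih + (b - a) * hs

/-- Let `A` be the real 2×2 matrix with rows `(2,1)` and
`(2,2)`.  Then the sequence
`c_k = (2+√2)^{-k} ((A^{k-1})_{2,1} (√2−1) + (A^{k-1})_{2,2} (2−√2))`, `k ≥ 1`,
converges as `k → ∞` with limit `3 − 2√2`. -/
theorem stmt15 :
    let A : Matrix (Fin 2) (Fin 2) ℝ := !![2, 1; 2, 2]
    let c : ℕ → ℝ := fun k =>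
      ((2 + Real.sqrt 2) ^ k)⁻¹ *
        ((A ^ (k - 1)) 1 0 * (Real.sqrt 2 - 1) + (A ^ (k - 1)) 1 1 * (2 - Real.sqrt 2))
    Filter.Tendsto c Filter.atTop (nhds (3 - 2 * Real.sqrt 2)) := by
  intro A c
  have hs : Real.sqrt 2 ^ 2 = 2 := Real.sq_sqrt (by norm_num)
  have hpos : 0 < 2 + Real.sqrt 2 := by positivity
  refine tendsto_const_nhds.congr' ?_
  filter_upwards [Filter.eventually_ge_atTop 1] with k hk
  obtain ⟨n, rfl⟩ := Nat.exists_eq_add_of_le' hk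
  simp only [c, A, Nat.add_sub_cancel]
  rw [matrix_pow_apply_eigenvector, eq_inv_mul_iff_mul_eq₀ (by positivity), pow_succ]
  linear_combination (-2 * (2 + Real.sqrt 2) ^ n) * hs
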